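/- Suppose the locations are independent and ∑_{ω_k∈Ω_k} μ_k(ω_k)h_k(ω_k) < 0 for every k ∈ {1,…,K}. Let v_1, …, v_K ∈ ℝ be location payoffs. Then there exist a decentralized signaling mechanism σ with signal set U = {0,1}^K and a strategy f ∈ F_d that is optimal under σ such that for every obedient direct mechanism ψ, V(σ, f) ≥ (1 − (1 − 1/K)^K) · ∑_{ω∈Ω} ∑_{k=1}^K μ(ω)ψ(k|ω)v_k. In particular, the optimal decentralized value Val_D and the optimal centralized value Val satisfy Val_D ≥ (1 − (1 − 1/K)^K)·Val. -/

import Mathlib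

open Finset in
/-- A probability distribution on a finite type. -/
def IsDist {α : Type*} [Fintype α] (ν : α → ℝ) : Prop :=
  (∀ a, 0 ≤ ν a) ∧ ∑ a, ν a = 1

open Finset in
/-- A signaling mechanism with (finite) signal set `S`: `σ ω s` is the probability of
sending signal `s` in state `ω`. -/
def IsMech {Ωt : Type*} {S : Type*} [Fintype S] (σ : Ωt → S → ℝ) : Prop :=
  (∀ ω s, 0 ≤ σ ω s) ∧ ∀ ω, ∑ s, σ ω s = 1

open Finset in
/-- A customer strategy on signal set `S`, choosing actions in `Option (Fin K)`
(`none` = do not join, `some k` = join location `k`). -/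
def IsStrat {S : Type*} [Fintype S] (K : ℕ) (f : S → Option (Fin K) → ℝ) : Prop :=
  (∀ s a, 0 ≤ f s a) ∧ ∀ s, ∑ a, f s a = 1

/-- The customer's utility for an action, with the convention `h_0 ≡ 0`. -/
def util {K : ℕ} {Ω : Fin K → Type*} (h : ∀ k, Ω k → ℝ) (ω : ∀ k, Ω k) :
    Option (Fin K) → ℝ
  | none => 0
  | some k => h k (ω k)

open Finset in
/-- Optimality of a strategy `f` under a mechanism `σ` (unnormalized posterior form). -/
def IsOptimal {K : ℕ} {Ω : Fin K → Type*} [∀ k, Fintype (Ω k)] {S : Type*} [Fintype S]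
    (μ : (∀ k, Ω k) → ℝ) (h : ∀ k, Ω k → ℝ)
    (σ : (∀ k, Ω k) → S → ℝ) (f : S → Option (Fin K) → ℝ) : Prop :=
  ∀ s : S, 0 < ∑ ω, μ ω * σ ω s → ∀ a, 0 < f s a → ∀ a',
    ∑ ω, μ ω * σ ω s * util h ω a' ≤ ∑ ω, μ ω * σ ω s * util h ω a

open Finset in
/-- The throughput `T(σ, f)`. -/
noncomputable def T {K : ℕ} {Ω : Fin K → Type*} [∀ k, Fintype (Ω k)] {S : Type*} [Fintype S]
    (μ : (∀ k, Ω k) → ℝ) (σ : (∀ k, Ω k) → S → ℝ) (f : S → Option (Fin K) → ℝ) : ℝ :=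
  ∑ ω, ∑ s, ∑ k : Fin K, μ ω * σ ω s * f s (some k)

/-- The class `F_d` of strategies on the binary signal set `U = {0,1}^K`. -/
def InFd {K : ℕ} (f : (Fin K → Bool) → Option (Fin K) → ℝ) : Prop :=
  IsStrat K f ∧ (∀ u : Fin K → Bool, u ≠ (fun _ => false) → f u none = 0) ∧
    ∀ (u : Fin K → Bool) (k : Fin K), u k = false → f u (some k) = 0

open Finset in
/-- Feasibility for the isolated linear program for `(ν, h)`: `g ω` is the probability of
sending signal `1` in state `ω`. -/
def IsoFeas {α : Type*} [Fintype α] (ν h g : α → ℝ) : Prop :=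
  (∀ a, 0 ≤ g a) ∧ (∀ a, g a ≤ 1) ∧
    0 ≤ ∑ a, ν a * g a * h a ∧ ∑ a, ν a * (1 - g a) * h a ≤ 0

open Finset in
/-- The optimal value `Th^iso(ν, h)` of the isolated linear program. -/
noncomputable def ThIso {α : Type*} [Fintype α] (ν h : α → ℝ) : ℝ :=
  sSup {x | ∃ g, IsoFeas ν h g ∧ x = ∑ a, ν a * g a}

open Finset in
/-- An obedient direct mechanism (signals are action recommendations in `Option (Fin K)`). -/
def Obedient {K : ℕ} {Ω : Fin K → Type*} [∀ k, Fintype (Ω k)]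
    (μ : (∀ k, Ω k) → ℝ) (h : ∀ k, Ω k → ℝ)
    (σ : (∀ k, Ω k) → Option (Fin K) → ℝ) : Prop :=
  (∀ k l : Fin K, ∑ ω, μ ω * σ ω (some k) * h l (ω l) ≤ ∑ ω, μ ω * σ ω (some k) * h k (ω k)) ∧
  (∀ k : Fin K, 0 ≤ ∑ ω, μ ω * σ ω (some k) * h k (ω k)) ∧
  (∀ k : Fin K, ∑ ω, μ ω * σ ω none * h k (ω k) ≤ 0)

open Finset in
/-- The system's value `V(σ, f)` under location payoffs `v`. -/
noncomputable def V {K : ℕ} {Ω : Fin K → Type*} [∀ k, Fintype (Ω k)] {S : Type*}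
    [Fintype S] (μ : (∀ k, Ω k) → ℝ) (σ : (∀ k, Ω k) → S → ℝ)
    (f : S → Option (Fin K) → ℝ) (v : Fin K → ℝ) : ℝ :=
  ∑ ω, ∑ s, ∑ k : Fin K, μ ω * σ ω s * f s (some k) * v k

lemma iso_exists {α : Type} [Fintype α] (ν h : α → ℝ) (hν : IsDist ν)
    (hneg : ∑ a, ν a * h a < 0) :
    ∃ g : α → ℝ, (∀ a, 0 ≤ g a) ∧ (∀ a, g a ≤ 1) ∧ ∑ a, ν a * g a * h a = 0 ∧
      ∀ g' : α → ℝ, (∀ a, 0 ≤ g' a) → (∀ a, g' a ≤ 1) → 0 ≤ ∑ a, ν a * g' a * h a →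
        ∑ a, ν a * g' a ≤ ∑ a, ν a * g a := by
  have hc : IsCompact (Set.Icc (0 : α → ℝ) 1 ∩ {g | 0 ≤ ∑ a, ν a * g a * h a}) := by
    apply isCompact_Icc.inter_right
    apply isClosed_le continuous_const
    fun_prop
  obtain ⟨g, ⟨⟨hg0, hg1⟩, hgS⟩, hmax⟩ := hc.exists_isMaxOn
    ⟨0, ⟨le_refl _, fun _ => zero_le_one⟩, by simp⟩
    (f := fun g : α → ℝ => ∑ a, ν a * g a) (by fun_prop)
  simp only [Set.mem_ofPred_eq] at hgS
  set S := ∑ a, ν a * g a * h a with hS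
  set M := ∑ a, ν a * h a with hM
  have hD : 0 < S - M := by linarith
  set t := S / (S - M) with ht
  have ht0 : 0 ≤ t := div_nonneg hgS hD.le
  have ht1 : t ≤ 1 := by rw [ht, div_le_one hD]; linarith
  have htS : t * (S - M) = S := div_mul_cancel₀ _ hD.ne'
  refine ⟨fun a => (1 - t) * g a + t, ?_, ?_, ?_, ?_⟩
  · intro a
    have := hg0 a
    simp only [Pi.zero_apply] at this
    have : 0 ≤ (1 - t) * g a := mul_nonneg (by linarith) this
    linarith
  · intro a
    have := hg1 a
    simp only [Pi.one_apply] at this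
    nlinarith
  · have : ∑ a, ν a * ((1 - t) * g a + t) * h a = (1 - t) * S + t * M := by
      rw [hS, hM, Finset.mul_sum, Finset.mul_sum, ← Finset.sum_add_distrib]
      exact Finset.sum_congr rfl fun a _ => by ring
    rw [this]; linarith
  · intro g' h0 h1 h2
    have h3 : ∑ a, ν a * g' a ≤ ∑ a, ν a * g a := hmax ⟨⟨h0, h1⟩, h2⟩
    have h4 : ∑ a, ν a * ((1 - t) * g a + t) = (1 - t) * (∑ a, ν a * g a) + t * ∑ a, ν a := by
      rw [Finset.mul_sum, Finset.mul_sum, ← Finset.sum_add_distrib]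
      exact Finset.sum_congr rfl fun a _ => by ring
    have h5 : ∑ a, ν a * g a ≤ 1 := by
      rw [← hν.2]
      exact Finset.sum_le_sum fun a _ => mul_le_of_le_one_right (hν.1 a) (hg1 a)
    rw [h4, hν.2]
    nlinarith

/-- A discrete layer-cake inequality. -/
lemma layer {K : ℕ} {U : Type} [Fintype U] (on : U → Fin K → Prop) (P : U → ℝ)
    (hP : ∀ u, 0 ≤ P u) (z : Fin K → ℝ)
    (hz : ∀ A : Finset (Fin K),
      ∑ i ∈ A, z i ≤ ∑ u, P u * (open Classical in if ∃ i ∈ A, on u i then 1 else 0)) :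
    ∀ n : ℕ, ∀ (w : Fin K → ℝ) (m : U → ℝ), (∀ i, 0 ≤ w i) → (∀ u, 0 ≤ m u) →
      (∀ u i, on u i → w i ≤ m u) → (Finset.univ.filter fun i => 0 < w i).card = n →
      ∑ i, z i * w i ≤ ∑ u, P u * m u := by
  classical
  intro n
  induction n using Nat.strong_induction_on with
  | _ n ih =>
  intro w m hw hm hon hcard
  set A := Finset.univ.filter fun i => 0 < w i with hA
  by_cases hne : A.Nonempty
  · obtain ⟨j, hjA, hj⟩ := A.exists_min_image w hne
    have hjp : 0 < w j := by simpa [hA] using hjA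
    have hwA : ∀ i, i ∉ A → w i = 0 := fun i hi => by
      have : ¬ 0 < w i := by simpa [hA] using hi
      exact le_antisymm (not_lt.1 this) (hw i)
    have key := ih _ ?_ (fun i => w i - if i ∈ A then w j else 0)
      (fun u => m u - w j * (if ∃ i ∈ A, on u i then 1 else 0)) ?_ ?_ ?_ rfl
    · have h1 : ∑ i, z i * (w i - if i ∈ A then w j else 0)
          = ∑ i, z i * w i - w j * ∑ i ∈ A, z i := by
        have h0 : ∑ i ∈ A, w j * z i = ∑ i, if i ∈ A then w j * z i else 0 := by simp
        rw [Finset.mul_sum, h0, ← Finset.sum_sub_distrib]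
        refine Finset.sum_congr rfl fun i _ => ?_
        split_ifs <;> ring
      have h2 : ∑ u, P u * (m u - w j * (if ∃ i ∈ A, on u i then 1 else 0))
          = ∑ u, P u * m u - w j * ∑ u, P u * (if ∃ i ∈ A, on u i then 1 else 0) := by
        rw [Finset.mul_sum, ← Finset.sum_sub_distrib]
        refine Finset.sum_congr rfl fun i _ => ?_
        ring
      rw [h1, h2] at key
      have h3 := mul_le_mul_of_nonneg_left (hz A) hjp.le
      have h4 : ∑ u, P u * (if ∃ i ∈ A, on u i then (1:ℝ) else 0) =
        ∑ u, P u * (open Classical in if ∃ i ∈ A, on u i then 1 else 0) := by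
        refine Finset.sum_congr rfl fun i _ => ?_
        congr
      rw [h4] at key
      linarith
    · rw [← hcard]
      apply Finset.card_lt_card
      rw [Finset.ssubset_iff_of_subset]
      · refine ⟨j, hjA, ?_⟩
        simp [hjA]
      · intro i hi
        by_contra hiA
        simp [hiA, hwA i hiA] at hi
    · intro i
      split_ifs with hi
      · have := hj i hi; linarith
      · simpa using hw i
    · intro u
      split_ifs with hi
      · obtain ⟨i, hi, hu⟩ := hi
        have := hj i hi; have := hon u i hu; linarith
      · simpa using hm u
    · intro u i hu
      by_cases hi : i ∈ A
      · have : ∃ i ∈ A, on u i := ⟨i, hi, hu⟩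
        have := hon u i hu
        simp_all
      · rw [if_neg hi, hwA i hi]
        split_ifs with h'
        · obtain ⟨i, hi, hu⟩ := h'
          have := hj i hi; have := hon u i hu; linarith
        · simpa using hm u
  · have : ∑ i, z i * w i = 0 := by
      apply Finset.sum_eq_zero
      intro i _
      have : ¬ 0 < w i := fun hi => hne ⟨i, by simpa [hA] using hi⟩
      rw [le_antisymm (not_lt.1 this) (hw i), mul_zero]
    rw [this]
    exact Finset.sum_nonneg fun u _ => mul_nonneg (hP u) (hm u)

/-- The product bound (AM-GM plus convexity). -/
lemma prod_bound {K : ℕ} (hK : 1 ≤ K) (y : Fin K → ℝ) (h0 : ∀ i, 0 ≤ y i)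
    (h1 : ∑ i, y i ≤ 1) :
    ∏ i, (1 - y i) ≤ 1 - (1 - (1 - 1 / (K : ℝ)) ^ K) * ∑ i, y i := by
  have hKr : (1 : ℝ) ≤ K := by exact_mod_cast hK
  have hK0 : (K : ℝ) ≠ 0 := by positivity
  set X := ∑ i, y i with hX
  have hX0 : 0 ≤ X := Finset.sum_nonneg fun i _ => h0 i
  have hy1 : ∀ i, y i ≤ 1 := fun i =>
    (Finset.single_le_sum (fun i _ => h0 i) (Finset.mem_univ i)).trans h1
  have amgm : ∏ i, (1 - y i) ≤ (1 - X / K) ^ K := by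
    have hz : ∀ i, 0 ≤ 1 - y i := fun i => by linarith [hy1 i]
    have := Real.geom_mean_le_arith_mean_weighted Finset.univ (fun _ : Fin K => 1 / (K : ℝ))
      (fun i => 1 - y i) (fun _ _ => by positivity) (by simp [hK0]) (fun i _ => hz i)
    have h2 := pow_le_pow_left₀ (Finset.prod_nonneg fun i _ => Real.rpow_nonneg (hz i) _) this K
    rw [← Finset.prod_pow] at h2
    have h3 : ∀ i, ((1 - y i) ^ (1 / (K : ℝ))) ^ K = 1 - y i := fun i => by
      rw [← Real.rpow_natCast, ← Real.rpow_mul (hz i), one_div_mul_cancel hK0, Real.rpow_one]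
    have h4 : ∑ i, 1 / (K : ℝ) * (1 - y i) = 1 - X / K := by
      rw [← Finset.mul_sum, Finset.sum_sub_distrib, ← hX]
      simp
      field_simp
    simp only [h3, h4] at h2
    exact h2
  refine amgm.trans ?_
  have hinv : 1 / (K : ℝ) ≤ 1 := by rw [div_le_one (by linarith)]; exact hKr
  have hm1 : (1 : ℝ) ∈ Set.Ici (0 : ℝ) := by simp
  have hm2 : 1 - 1 / (K : ℝ) ∈ Set.Ici (0 : ℝ) := by
    rw [Set.mem_Ici]; linarith
  have ha : 0 ≤ 1 - X := by linarith
  have hab : 1 - X + X = 1 := by ring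
  have hcv := (convexOn_pow (𝕜 := ℝ) K).2 hm1 hm2 ha hX0 hab
  simp only [smul_eq_mul, one_pow, mul_one] at hcv
  have e : 1 - X + X * (1 - 1 / (K : ℝ)) = 1 - X / K := by ring
  rw [e] at hcv
  linarith

/-- Resampling one coordinate. -/
lemma resample {K : ℕ} {Ω : Fin K → Type} [∀ k, Fintype (Ω k)]
    (μk : ∀ k, Ω k → ℝ) (hμ : ∀ k, IsDist (μk k)) (k : Fin K)
    (F : (∀ k, Ω k) → ℝ) :
    ∑ a : Ω k, μk k a * ∑ ω, (∏ j, μk j (ω j)) * F (Function.update ω k a)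
      = ∑ ω, (∏ j, μk j (ω j)) * F ω := by
  have e1 : ∑ a : Ω k, μk k a * ∑ ω, (∏ j, μk j (ω j)) * F (Function.update ω k a)
      = ∑ p : Ω k × (∀ j, Ω j), μk k p.1 *
        ((∏ j, μk j (p.2 j)) * F (Function.update p.2 k p.1)) := by
    rw [Fintype.sum_prod_type]
    simp only [Finset.mul_sum]
  have e2 : ∑ p : Ω k × (∀ j, Ω j), μk k p.1 *
        ((∏ j, μk j (p.2 j)) * F (Function.update p.2 k p.1))
      = ∑ p : Ω k × (∀ j, Ω j), μk k p.1 * ((∏ j, μk j (p.2 j)) * F p.2) := by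
    refine Finset.sum_nbij' (fun p => (p.2 k, Function.update p.2 k p.1))
      (fun p => (p.2 k, Function.update p.2 k p.1)) (by simp) (by simp) (by simp) (by simp) ?_
    rintro ⟨a, ω⟩ -
    dsimp only
    have hp : ∀ ω : (∀ j, Ω j), ∏ j, μk j (ω j)
        = μk k (ω k) * ∏ j ∈ Finset.univ.erase k, μk j (ω j) := fun ω =>
      (Finset.mul_prod_erase _ (fun j => μk j (ω j)) (Finset.mem_univ k)).symm
    have hq : ∏ j ∈ Finset.univ.erase k, μk j (Function.update ω k a j)
        = ∏ j ∈ Finset.univ.erase k, μk j (ω j) :=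
      Finset.prod_congr rfl fun j hj => by
        rw [Function.update_of_ne (Finset.ne_of_mem_erase hj)]
    rw [hp ω, hp (Function.update ω k a), hq, Function.update_self]
    ring
  rw [e1, e2, Fintype.sum_prod_type]
  simp only [← Finset.mul_sum, ← Finset.sum_mul, (hμ k).2, one_mul]

lemma sum_prod_pi {K : ℕ} {Ω : Fin K → Type} [∀ k, Fintype (Ω k)] (F : ∀ k, Ω k → ℝ) :
    ∑ ω : ∀ k, Ω k, ∏ k, F k (ω k) = ∏ k, ∑ a, F k a := by
  classical
  rw [Finset.prod_univ_sum, Fintype.piFinset_univ]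

lemma obed_le {K : ℕ} {Ω : Fin K → Type} [∀ k, Fintype (Ω k)]
    (μk : ∀ k, Ω k → ℝ) (hμ : ∀ k, IsDist (μk k)) (h : ∀ k, Ω k → ℝ) (k : Fin K) (p : ℝ)
    (hp : ∀ g' : Ω k → ℝ, (∀ a, 0 ≤ g' a) → (∀ a, g' a ≤ 1) →
        0 ≤ ∑ a, μk k a * g' a * h k a → ∑ a, μk k a * g' a ≤ p)
    (φ : (∀ k, Ω k) → ℝ) (h0 : ∀ ω, 0 ≤ φ ω) (h1 : ∀ ω, φ ω ≤ 1)
    (ho : 0 ≤ ∑ ω, (∏ j, μk j (ω j)) * φ ω * h k (ω k)) :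
    ∑ ω, (∏ j, μk j (ω j)) * φ ω ≤ p := by
  have hμ0 : ∀ ω : ∀ k, Ω k, 0 ≤ ∏ j, μk j (ω j) := fun ω =>
    Finset.prod_nonneg fun j _ => (hμ j).1 _
  have hμ1 : ∑ ω : ∀ k, Ω k, ∏ j, μk j (ω j) = 1 := by
    rw [sum_prod_pi]; exact Finset.prod_eq_one fun j _ => (hμ j).2
  rw [← resample μk hμ k]
  apply hp
  · exact fun a => Finset.sum_nonneg fun ω _ => mul_nonneg (hμ0 ω) (h0 _)
  · intro a
    rw [← hμ1]
    exact Finset.sum_le_sum fun ω _ => mul_le_of_le_one_right (hμ0 ω) (h1 _)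
  · refine ho.trans_eq ?_
    simp only [mul_assoc]
    rw [← resample μk hμ k]
    refine Finset.sum_congr rfl fun a _ => ?_
    rw [Finset.sum_mul]
    simp only [Function.update_self, mul_assoc]

lemma exists_choice {K : ℕ} (v : Fin K → ℝ) (u : Fin K → Bool) :
    ∃ c : Option (Fin K), (c = none ∧ ∀ k, u k = false) ∨
      ∃ k, c = some k ∧ u k = true ∧ ∀ l, u l = true → v l ≤ v k := by
  by_cases hne : (Finset.univ.filter fun k => u k = true).Nonempty
  · obtain ⟨k, hk, hmax⟩ := Finset.exists_max_image _ v hne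
    refine ⟨some k, Or.inr ⟨k, rfl, by simpa using hk, fun l hl => hmax l (by simpa using hl)⟩⟩
  · refine ⟨none, Or.inl ⟨rfl, fun k => ?_⟩⟩
    by_contra hk
    exact hne ⟨k, by simpa using hk⟩

lemma hit_prob {K : ℕ} (p : Fin K → ℝ) (q : Fin K → Bool → ℝ) (hq1 : ∀ k, q k true = p k)
    (hq0 : ∀ k, q k false = 1 - p k) (A : Finset (Fin K)) :
    ∑ u : Fin K → Bool, (∏ k, q k (u k)) *
      (open Classical in if ∃ i ∈ A, u i = true then (1 : ℝ) else 0)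
      = 1 - ∏ i ∈ A, (1 - p i) := by
  classical
  have h1 : ∑ u : Fin K → Bool, ∏ k, q k (u k) = 1 := by
    rw [sum_prod_pi (Ω := fun _ : Fin K => Bool)]
    exact Finset.prod_eq_one fun k _ => by simp [hq1, hq0]
  have h2 : ∑ u : Fin K → Bool, ∏ k, (q k (u k) * if k ∈ A ∧ u k = true then 0 else 1)
      = ∏ i ∈ A, (1 - p i) := by
    rw [sum_prod_pi (Ω := fun _ : Fin K => Bool)
      (fun k b => q k b * if k ∈ A ∧ b = true then 0 else 1)]
    rw [← Finset.prod_subset (Finset.subset_univ A)]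
    · refine Finset.prod_congr rfl fun i hi => ?_
      simp [hi, hq0]
    · intro i _ hi
      simp [hi, hq0, hq1]
  rw [← h2]
  nth_rewrite 2 [← h1]
  rw [← Finset.sum_sub_distrib]
  refine Finset.sum_congr rfl fun u _ => ?_
  rw [Finset.prod_mul_distrib]
  by_cases hu : ∃ i ∈ A, u i = true
  · obtain ⟨i, hi, hui⟩ := hu
    have : ∏ k, (if k ∈ A ∧ u k = true then (0 : ℝ) else 1) = 0 :=
      Finset.prod_eq_zero (Finset.mem_univ i) (by simp [hi, hui])
    rw [this, if_pos ⟨i, hi, hui⟩]; ring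
  · have : ∏ k, (if k ∈ A ∧ u k = true then (0 : ℝ) else 1) = 1 :=
      Finset.prod_eq_one fun k _ => if_neg fun hk => hu ⟨k, hk⟩
    rw [this, if_neg hu]; ring

lemma post_util {K : ℕ} {Ω : Fin K → Type} [∀ k, Fintype (Ω k)]
    (μk : ∀ k, Ω k → ℝ) (h : ∀ k, Ω k → ℝ) (σk : ∀ k, Ω k → Bool → ℝ)
    (u : Fin K → Bool) (l : Fin K) :
    ∑ ω : ∀ k, Ω k, (∏ k, μk k (ω k)) * (∏ k, σk k (ω k) (u k)) * h l (ω l)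
      = (∑ a, μk l a * σk l a (u l) * h l a) *
        ∏ k ∈ Finset.univ.erase l, ∑ a, μk k a * σk k a (u k) := by
  have e := sum_prod_pi (Ω := Ω)
    (fun k a => μk k a * σk k a (u k) * if k = l then h k a else 1)
  have e1 : ∀ ω : ∀ k, Ω k, ∏ k, (μk k (ω k) * σk k (ω k) (u k) * if k = l then h k (ω k) else 1)
      = (∏ k, μk k (ω k)) * (∏ k, σk k (ω k) (u k)) * h l (ω l) := fun ω => by
    rw [Finset.prod_mul_distrib, Finset.prod_mul_distrib]
    congr 1
    simp
  rw [← Finset.sum_congr rfl fun ω _ => e1 ω, e, ← Finset.mul_prod_erase _ _ (Finset.mem_univ l)]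
  congr 1
  · simp
  · refine Finset.prod_congr rfl fun k hk => ?_
    simp [Finset.ne_of_mem_erase hk]

open Finset in
/-- Theorem 4. For independent locations with
`∑_{ω_k} μ_k(ω_k) h_k(ω_k) < 0` for every `k`, and any payoffs `v`, there exist a
decentralized mechanism `σ` with binary signals and an optimal strategy `f ∈ F_d` such
that for every obedient direct mechanism `ψ`,
`V(σ,f) ≥ (1 − (1 − 1/K)^K) · ∑_ω ∑_k μ(ω) ψ(k|ω) v_k`. -/
theorem stmt12 {K : ℕ} (hK : 1 ≤ K) {Ω : Fin K → Type} [∀ k, Fintype (Ω k)]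
    [∀ k, Nonempty (Ω k)]
    (μk : ∀ k, Ω k → ℝ) (hμ : ∀ k, IsDist (μk k))
    (h : ∀ k, Ω k → ℝ)
    (hneg : ∀ k, (∑ ωk, μk k ωk * h k ωk) < 0)
    (v : Fin K → ℝ) :
    ∃ σk : ∀ k, Ω k → Bool → ℝ, (∀ k, IsMech (σk k)) ∧
      ∃ f : (Fin K → Bool) → Option (Fin K) → ℝ, InFd f ∧
        IsOptimal (fun ω => ∏ k, μk k (ω k)) h
          (fun ω u => ∏ k, σk k (ω k) (u k)) f ∧
        ∀ ψ : (∀ k, Ω k) → Option (Fin K) → ℝ, IsMech ψ →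
          Obedient (fun ω => ∏ k, μk k (ω k)) h ψ →
          (1 - (1 - 1 / (K : ℝ)) ^ K) *
              (∑ ω, ∑ k : Fin K, (∏ j, μk j (ω j)) * ψ ω (some k) * v k) ≤
            V (fun ω => ∏ k, μk k (ω k)) (fun ω u => ∏ k, σk k (ω k) (u k)) f v := by
  classical
  have hiso : ∀ k, ∃ g : Ω k → ℝ, (∀ a, 0 ≤ g a) ∧ (∀ a, g a ≤ 1) ∧
      ∑ a, μk k a * g a * h k a = 0 ∧
      (v k < 0 → ∀ a, g a = 0) ∧
      (0 ≤ v k → ∀ g' : Ω k → ℝ, (∀ a, 0 ≤ g' a) → (∀ a, g' a ≤ 1) →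
        0 ≤ ∑ a, μk k a * g' a * h k a → ∑ a, μk k a * g' a ≤ ∑ a, μk k a * g a) := by
    intro k
    by_cases hv : v k < 0
    · exact ⟨fun _ => 0, by simp, by simp, by simp, by simp, fun h' => absurd hv (not_lt.2 h')⟩
    · obtain ⟨g, h0, h1, h2, h3⟩ := iso_exists (μk k) (h k) (hμ k) (hneg k)
      exact ⟨g, h0, h1, h2, fun h' => absurd h' hv, fun _ => h3⟩
  choose g hg0 hg1 hgb hgn hgm using hiso
  choose c hc using exists_choice v
  set σk : ∀ k, Ω k → Bool → ℝ := fun k a b => if b = true then g k a else 1 - g k a with hσ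
  have hσ0 : ∀ k a b, 0 ≤ σk k a b := by
    intro k a b
    simp only [hσ]
    split_ifs
    · exact hg0 k a
    · linarith [hg1 k a]
  set q : Fin K → Bool → ℝ := fun k b => ∑ a, μk k a * σk k a b with hq
  have hq0 : ∀ k b, 0 ≤ q k b := fun k b =>
    Finset.sum_nonneg fun a _ => mul_nonneg ((hμ k).1 a) (hσ0 k a b)
  set p : Fin K → ℝ := fun k => ∑ a, μk k a * g k a with hp
  have hqt : ∀ k, q k true = p k := fun k => by simp [hq, hσ, hp]
  have hqf : ∀ k, q k false = 1 - p k := fun k => by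
    simp [hq, hσ, hp, mul_sub, Finset.sum_sub_distrib, (hμ k).2]
  have hp1 : ∀ k, p k ≤ 1 := fun k => by linarith [hqf k, hq0 k false]
  have hpn : ∀ k, v k < 0 → p k = 0 := fun k hk => by simp [hp, hgn k hk]
  set f : (Fin K → Bool) → Option (Fin K) → ℝ := fun u a => if a = c u then 1 else 0 with hf
  have hut : ∀ (u : Fin K → Bool) l, u l = true → ∑ ω : ∀ k, Ω k,
      (∏ k, μk k (ω k)) * (∏ k, σk k (ω k) (u k)) * h l (ω l) = 0 := by
    intro u l hl
    rw [post_util]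
    simp [hl, hσ, hgb]
  have hule : ∀ (u : Fin K → Bool) l, ∑ ω : ∀ k, Ω k,
      (∏ k, μk k (ω k)) * (∏ k, σk k (ω k) (u k)) * h l (ω l) ≤ 0 := by
    intro u l
    cases hl : u l
    · rw [post_util]
      apply mul_nonpos_of_nonpos_of_nonneg
      · have : ∑ a, μk l a * σk l a (u l) * h l a
            = ∑ a, μk l a * h l a - ∑ a, μk l a * g l a * h l a := by
          rw [← Finset.sum_sub_distrib]
          refine Finset.sum_congr rfl fun a _ => ?_
          simp only [hσ, hl]
          simp
          ring
        rw [this, hgb]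
        linarith [hneg l]
      · exact Finset.prod_nonneg fun k _ => hq0 k _
    · exact (hut u l hl).le
  refine ⟨σk, fun k => ⟨hσ0 k, fun a => by simp [hσ]⟩, f, ⟨⟨?_, ?_⟩, ?_, ?_⟩, ?_, ?_⟩
  · intro u a
    simp only [hf]
    split_ifs <;> norm_num
  · intro u
    simp [hf]
  · intro u hu
    rcases hc u with ⟨_, h2⟩ | ⟨k, h1, _⟩
    · exact absurd (funext h2) hu
    · simp [hf, h1]
  · intro u k hk
    rcases hc u with ⟨h1, _⟩ | ⟨l, h1, h2, _⟩
    · simp [hf, h1]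
    · have : k ≠ l := by rintro rfl; simp [hk] at h2
      simp [hf, h1, this]
  · intro u _ a ha a'
    have hac : a = c u := by
      by_contra hne
      simp [hf, hne] at ha
    have hR : ∑ ω : ∀ k, Ω k, (∏ k, μk k (ω k)) * (∏ k, σk k (ω k) (u k)) * util h ω a = 0 := by
      rcases hc u with ⟨h1, _⟩ | ⟨l, h1, h2, _⟩
      · rw [hac, h1]; simp [util]
      · rw [hac, h1]; exact hut u l h2
    refine le_trans ?_ hR.ge
    cases a' with
    | none => simp [util]
    | some l => exact hule u l
  · intro ψ hψ hob
    have hμ0 : ∀ ω : ∀ k, Ω k, 0 ≤ ∏ j, μk j (ω j) := fun ω =>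
      Finset.prod_nonneg fun j _ => (hμ j).1 _
    have hμ1 : ∑ ω : ∀ k, Ω k, ∏ j, μk j (ω j) = 1 := by
      rw [sum_prod_pi]; exact Finset.prod_eq_one fun j _ => (hμ j).2
    have hψs : ∀ ω, ∑ k : Fin K, ψ ω (some k) ≤ 1 := fun ω => by
      have := hψ.2 ω
      rw [Fintype.sum_option] at this
      linarith [hψ.1 ω none]
    have hψ1 : ∀ ω k, ψ ω (some k) ≤ 1 := fun ω k =>
      (Finset.single_le_sum (f := fun k : Fin K => ψ ω (some k)) (fun i _ => hψ.1 ω (some i))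
        (Finset.mem_univ k)).trans (hψs ω)
    set x : Fin K → ℝ := fun k => ∑ ω, (∏ j, μk j (ω j)) * ψ ω (some k) with hx
    have hx0 : ∀ k, 0 ≤ x k := fun k =>
      Finset.sum_nonneg fun ω _ => mul_nonneg (hμ0 ω) (hψ.1 _ _)
    have hxs : ∑ k, x k ≤ 1 := by
      simp only [hx]
      rw [Finset.sum_comm, ← hμ1]
      refine Finset.sum_le_sum fun ω _ => ?_
      rw [← Finset.mul_sum]
      exact mul_le_of_le_one_right (hμ0 ω) (hψs ω)
    have hxp : ∀ k, 0 ≤ v k → x k ≤ p k := fun k hk =>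
      obed_le μk hμ h k (p k) (hgm k hk) (fun ω => ψ ω (some k)) (fun ω => hψ.1 _ _)
        (fun ω => hψ1 ω k) (hob.2.1 k)
    set C : ℝ := 1 - (1 - 1 / (K : ℝ)) ^ K with hC
    have hKr : (1 : ℝ) ≤ K := by exact_mod_cast hK
    have hinv : 1 / (K : ℝ) ≤ 1 := by rw [div_le_one (by linarith)]; exact hKr
    have hC0 : 0 ≤ C := by
      have : (1 - 1 / (K : ℝ)) ^ K ≤ 1 := pow_le_one₀ (by linarith) (by
        have : 0 ≤ 1 / (K : ℝ) := by positivity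
        linarith)
      linarith
    have hL : ∑ ω, ∑ k : Fin K, (∏ j, μk j (ω j)) * ψ ω (some k) * v k = ∑ k, x k * v k := by
      rw [Finset.sum_comm]
      simp only [hx, Finset.sum_mul]
    set P : (Fin K → Bool) → ℝ := fun u => ∏ k, q k (u k) with hP
    have hP0 : ∀ u, 0 ≤ P u := fun u => Finset.prod_nonneg fun k _ => hq0 k _
    set val : (Fin K → Bool) → ℝ := fun u => ∑ k, f u (some k) * v k with hval
    have hV : V (fun ω : ∀ k, Ω k => ∏ k, μk k (ω k))
        (fun ω u => ∏ k, σk k (ω k) (u k)) f v = ∑ u, P u * val u := by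
      unfold V
      rw [Finset.sum_comm]
      refine Finset.sum_congr rfl fun u _ => ?_
      have : P u = ∑ ω : ∀ k, Ω k, (∏ k, μk k (ω k)) * ∏ k, σk k (ω k) (u k) := by
        simp only [hP, hq]
        rw [← sum_prod_pi (Ω := Ω) (fun k a => μk k a * σk k a (u k))]
        simp only [Finset.prod_mul_distrib]
      rw [this, Finset.sum_mul]
      refine Finset.sum_congr rfl fun ω _ => ?_
      simp only [hval, Finset.mul_sum, mul_assoc]
    have hvc : ∀ u, (val u = 0 ∧ ∀ k, u k = false) ∨
        ∃ k, val u = v k ∧ u k = true ∧ ∀ l, u l = true → v l ≤ v k := by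
      intro u
      rcases hc u with ⟨h1, h2⟩ | ⟨l, h1, h2⟩
      · left; exact ⟨by simp [hval, hf, h1], h2⟩
      · right; exact ⟨l, by simp [hval, hf, h1], h2⟩
    have hPv : ∑ u, P u * val u = ∑ u, P u * max (val u) 0 := by
      refine Finset.sum_congr rfl fun u _ => ?_
      rcases le_or_gt 0 (val u) with h' | h'
      · rw [max_eq_left h']
      · rcases hvc u with ⟨h1, _⟩ | ⟨k, h1, h2, _⟩
        · linarith
        · have : P u = 0 := Finset.prod_eq_zero (Finset.mem_univ k) (by
            rw [h2, hqt, hpn k (by linarith)])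
          rw [this]; ring
    rw [hL, hV, hPv]
    set z : Fin K → ℝ := fun k => C * (if 0 ≤ v k then x k else 0) with hz
    have hfin := layer (fun (u : Fin K → Bool) i => u i = true) P hP0 z ?_ _
      (fun k => max (v k) 0) (fun u => max (val u) 0) (fun _ => le_max_right _ _)
      (fun _ => le_max_right _ _) ?_ rfl
    · refine le_trans ?_ hfin
      rw [Finset.mul_sum]
      refine Finset.sum_le_sum fun k _ => ?_
      simp only [hz]
      rw [mul_assoc]
      refine mul_le_mul_of_nonneg_left ?_ hC0
      split_ifs with hk
      · rw [max_eq_left hk]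
      · rw [zero_mul]
        exact mul_nonpos_of_nonneg_of_nonpos (hx0 k) (not_le.1 hk).le
    · intro A
      have hhit := hit_prob p q hqt hqf A
      have hge : 1 - ∏ i ∈ A, (1 - p i) ≤ ∑ u, P u *
          (open Classical in if ∃ i ∈ A, (fun (u : Fin K → Bool) i => u i = true) u i
            then (1 : ℝ) else 0) := by
        rw [← hhit]
      refine le_trans ?_ (hge.trans (le_of_eq ?_))
      rotate_left
      · refine Finset.sum_congr rfl fun u _ => ?_
        congr
      set y : Fin K → ℝ := fun k => if k ∈ A then (if 0 ≤ v k then x k else 0) else 0 with hy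
      have hy0 : ∀ k, 0 ≤ y k := fun k => by
        simp only [hy]
        split_ifs <;> first | exact hx0 k | exact le_rfl
      have hyx : ∀ k, y k ≤ x k := fun k => by
        simp only [hy]
        split_ifs <;> first | exact hx0 k | exact le_rfl
      have hb := prod_bound hK y hy0 ((Finset.sum_le_sum fun k _ => hyx k).trans hxs)
      have hzy : ∑ i ∈ A, z i = C * ∑ i, y i := by
        simp only [hz, hy, ← Finset.mul_sum]
        congr 1
        simp
      have hpy : ∏ i ∈ A, (1 - p i) ≤ ∏ i, (1 - y i) := by
        rw [← Finset.prod_subset (Finset.subset_univ A)]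
        · refine Finset.prod_le_prod (fun i _ => by linarith [hp1 i]) fun i hi => ?_
          simp only [hy, if_pos hi]
          split_ifs with hv
          · linarith [hxp i hv]
          · linarith [hpn i (not_le.1 hv)]
        · intro i _ hi
          simp [hy, hi]
      rw [hzy]
      linarith
    · intro u i hi
      rcases hvc u with ⟨_, h2⟩ | ⟨k, h1, _, h3⟩
      · simp [h2 i] at hi
      · rw [h1]; exact max_le_max (h3 i hi) le_rfl
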